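/- Let M be a monotone Möbius structure on S¹ satisfying the Increment axiom. For any closed zig-zag path S ⊂ Harm and any side σ of S, the length of σ is strictly less than the sum of the lengths of the other sides: |σ| < Σ_{σ'≠σ} |σ'|. -/

import Mathlib

open scoped Classical

section Mobius

variable {X : Type*}

/-- The pairs `(x,y)` and `(z,u)` separate each other on the circularly ordered set `X`:
`z` and `u` lie on different open arcs determined by `x` and `y`. -/
def PairSeparates [CircularOrder X] (x y z u : X) : Prop :=
  (sbtw x z y ∧ sbtw y u x) ∨ (sbtw x u y ∧ sbtw y z x)

/-- The pair `(d₁,d₂)` separates the pairs `(b₁,b₂)` and `(c₁,c₂)`: the latter two pairs lie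
on different open arcs determined by `(d₁,d₂)`. -/
def ArcSepPairs [CircularOrder X] (d₁ d₂ b₁ b₂ c₁ c₂ : X) : Prop :=
  (sbtw d₁ b₁ d₂ ∧ sbtw d₁ b₂ d₂ ∧ sbtw d₂ c₁ d₁ ∧ sbtw d₂ c₂ d₁) ∨
  (sbtw d₁ c₁ d₂ ∧ sbtw d₁ c₂ d₂ ∧ sbtw d₂ b₁ d₁ ∧ sbtw d₂ b₂ d₁)

/-- Two pairs `(b₁,b₂)` and `(c₁,c₂)` of points are in the strong causal relation:
either of them lies entirely in one open arc determined by the other. -/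
def StrongCausal [CircularOrder X] (b₁ b₂ c₁ c₂ : X) : Prop :=
  (sbtw b₁ c₁ b₂ ∧ sbtw b₁ c₂ b₂) ∨ (sbtw b₂ c₁ b₁ ∧ sbtw b₂ c₂ b₁) ∨
  (sbtw c₁ b₁ c₂ ∧ sbtw c₁ b₂ c₂) ∨ (sbtw c₂ b₁ c₁ ∧ sbtw c₂ b₂ c₁)

/-- The topology generated by open balls of the semi-metrics with infinitely remote points,
centered at finite points. `D ω x y` denotes `|xy|` in the semi-metric with infinitely remote
point `ω`. -/
def MTopology (D : X → X → X → ℝ) : TopologicalSpace X :=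
  TopologicalSpace.generateFrom
    {s | ∃ ω x r, x ≠ ω ∧ s = {y | y ≠ ω ∧ D ω x y < r}}

/-- A (ptolemaic) monotone Möbius structure on a circle `X`, presented by the family of its
semi-metrics with infinitely remote points: `D ω x y` is the distance `|xy|_ω` in the
semi-metric with infinitely remote point `ω` (defined for `x, y ≠ ω`).  The semi-metrics
are pairwise related by metric inversion (up to homothety), every one of them satisfies the
Ptolemy inequality, the monotonicity axiom (M) holds, the M-topology is the given topology
of `X`, and `X` is homeomorphic to the circle. -/
structure MonotoneMobius (X : Type*) [CircularOrder X] [t : TopologicalSpace X] where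
  D : X → X → X → ℝ
  symm : ∀ ω x y, D ω x y = D ω y x
  refl : ∀ ω x, D ω x x = 0
  pos : ∀ ω x y, x ≠ y → x ≠ ω → y ≠ ω → 0 < D ω x y
  inversion : ∀ ω ω', ω ≠ ω' → ∃ c : ℝ, 0 < c ∧ ∀ x y, x ≠ ω → y ≠ ω → x ≠ ω' → y ≠ ω' →
    D ω' x y = c * D ω x y / (D ω x ω' * D ω y ω')
  ptolemy : ∀ ω x y z u, x ≠ ω → y ≠ ω → z ≠ ω → u ≠ ω →
    D ω x y * D ω z u ≤ D ω x z * D ω y u + D ω x u * D ω y z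
  mono : ∀ ω x y z u, x ≠ ω → y ≠ ω → z ≠ ω → u ≠ ω → PairSeparates x y z u →
    D ω x z * D ω y u < D ω x y * D ω z u ∧ D ω x u * D ω y z < D ω x y * D ω z u
  mtop : MTopology D = t
  circle : Nonempty (X ≃ₜ AddCircle (1 : ℝ))

variable [CircularOrder X] [TopologicalSpace X]

/-- The 4-tuple `(x,y,z,u)` is harmonic (of the first type): `|xz||yu| = |xu||yz|` in any
semi-metric of the Möbius structure. -/
def MonotoneMobius.Harmonic (M : MonotoneMobius X) (x y z u : X) : Prop :=
  ∀ ω, ω ≠ x → ω ≠ y → ω ≠ z → ω ≠ u →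
    M.D ω x z * M.D ω y u = M.D ω x u * M.D ω y z

/-- The distance `|q q'| = |ln ((|xp'||yp|)/(|xp||yp'|))|` between two harmonic pairs
`q = ((x,y),(p,·))` and `q' = ((x,y),(p',·))` with common axis `(x,y)`; computed here in the
semi-metric with infinitely remote point `x`, where it equals `|ln (|yp|_x / |yp'|_x)|`. -/
noncomputable def MonotoneMobius.lineDist (M : MonotoneMobius X) (x y p p' : X) : ℝ :=
  |Real.log (M.D x y p / M.D x y p')|

end Mobius

section Harm

variable {X : Type*} [CircularOrder X] [TopologicalSpace X]

/-- A point of the space `Harm`: a harmonic pair `((x,y),(z,u))` of pairs of distinct points,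
with left axis `(x,y)` and right axis `(z,u)` (the entries of each axis being unordered). -/
structure HarmPt (M : MonotoneMobius X) where
  x : X
  y : X
  z : X
  u : X
  hxy : x ≠ y
  hxz : x ≠ z
  hxu : x ≠ u
  hyz : y ≠ z
  hyu : y ≠ u
  hzu : z ≠ u
  harm : M.Harmonic x y z u

variable {M : MonotoneMobius X}

/-- `q` and `q'` have the same left axis (as unordered pairs), i.e. lie on a common left line. -/
def leftAxisEq (q q' : HarmPt M) : Prop :=
  (q.x = q'.x ∧ q.y = q'.y) ∨ (q.x = q'.y ∧ q.y = q'.x)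

/-- `q` and `q'` have the same right axis (as unordered pairs), i.e. lie on a common right line. -/
def rightAxisEq (q q' : HarmPt M) : Prop :=
  (q.z = q'.z ∧ q.u = q'.u) ∨ (q.z = q'.u ∧ q.u = q'.z)

/-- The length of the left segment from `q` to `q'` (lying on a common left line). -/
noncomputable def stepDistL (q q' : HarmPt M) : ℝ := M.lineDist q.x q.y q.z q'.z

/-- The length of the right segment from `q` to `q'` (lying on a common right line). -/
noncomputable def stepDistR (q q' : HarmPt M) : ℝ := M.lineDist q.z q.u q.x q'.x

/-- `ZZ q q' b n L` : there is a zig-zag path from `q` to `q'` with `n` sides of total length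
`L`, alternating between left and right segments, whose first side is a left segment if
`b = true` and a right segment if `b = false`; sides are nondegenerate (they join distinct
points of `Harm`). -/
inductive ZZ : HarmPt M → HarmPt M → Bool → ℕ → ℝ → Prop
  | nil (q : HarmPt M) (b : Bool) : ZZ q q b 0 0
  | left {q q' qe : HarmPt M} {n : ℕ} {L : ℝ} (hne : ¬ rightAxisEq q q')
      (hax : leftAxisEq q q') (rest : ZZ q' qe false n L) :
      ZZ q qe true (n + 1) (stepDistL q q' + L)
  | right {q q' qe : HarmPt M} {n : ℕ} {L : ℝ} (hne : ¬ leftAxisEq q q')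
      (hax : rightAxisEq q q') (rest : ZZ q' qe true n L) :
      ZZ q qe false (n + 1) (stepDistR q q' + L)

/-- The zig-zag distance `δ(q,q')`: the infimum of the lengths of zig-zag paths from `q` to
`q'` (`⊤` if there is none). -/
noncomputable def zzDist (q q' : HarmPt M) : ENNReal :=
  sInf {e : ENNReal | ∃ (r : ℝ) (b : Bool) (n : ℕ), ZZ q q' b n r ∧ e = ENNReal.ofReal r}

end Harm

section Increment

variable {X : Type*} [CircularOrder X] [TopologicalSpace X]

/-- The seven points are in cyclic order `1234567` on the circle. -/
def Cyclic7 [CircularOrder X] (x1 x2 x3 x4 x5 x6 x7 : X) : Prop :=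
  sbtw x1 x2 x3 ∧ sbtw x2 x3 x4 ∧ sbtw x3 x4 x5 ∧ sbtw x4 x5 x6 ∧
  sbtw x5 x6 x7 ∧ sbtw x6 x7 x1 ∧ sbtw x7 x1 x2

/-- Increment Axiom (I): for any nondegenerate 7-tuple `q` in cyclic order `1234567` such
that `q_{247}` and `q_{157}` are harmonic, `cr₁(q_{345}) > cr₁(q_{123})` (in any semi-metric
of the structure finite on the tuple). -/
def MonotoneMobius.Increment (M : MonotoneMobius X) : Prop :=
  ∀ x1 x2 x3 x4 x5 x6 x7 : X, Cyclic7 x1 x2 x3 x4 x5 x6 x7 →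
    M.Harmonic x1 x3 x5 x6 → M.Harmonic x2 x3 x4 x6 →
    ∀ ω, ω ≠ x1 → ω ≠ x2 → ω ≠ x3 → ω ≠ x4 → ω ≠ x5 → ω ≠ x6 → ω ≠ x7 →
      M.D ω x4 x6 * M.D ω x5 x7 / (M.D ω x4 x7 * M.D ω x5 x6) <
      M.D ω x1 x6 * M.D ω x2 x7 / (M.D ω x1 x7 * M.D ω x2 x6)

end Increment

section CircularOrderLemmas

variable {X : Type*} [CircularOrder X]

theorem sbtw_or_sbtw_of_ne {a b c : X} (hab : a ≠ b) (hbc : b ≠ c) (hac : a ≠ c) :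
    sbtw a b c ∨ sbtw a c b := by
  by_contra! h
  rw [sbtw_iff_not_btw, sbtw_iff_not_btw, not_not, not_not] at h
  rcases h.1.antisymm (h.2.cyclic_left.cyclic_left) with h | h | h
  · exact hbc h.symm
  · exact hab h.symm
  · exact hac h

/-- Cutting the circle at `ω` yields a transitive relation `sbtw ω`. -/
theorem sbtw_cut_trans {ω a b c : X} (hab : sbtw ω a b) (hbc : sbtw ω b c) : sbtw ω a c :=
  sbtw_trans_right hab hbc

theorem sbtw_of_cut {ω a b c : X} (hab : sbtw ω a b) (hbc : sbtw ω b c) : sbtw a b c :=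
  (SBtw.sbtw.trans_left hbc.cyclic_right hab).cyclic_left

theorem sbtw_cut_or {ω a b : X} (ha : a ≠ ω) (hb : b ≠ ω) (hab : a ≠ b) :
    sbtw ω a b ∨ sbtw ω b a :=
  sbtw_or_sbtw_of_ne ha.symm hab hb.symm

theorem SBtw.sbtw.ne_left {a b c : X} (h : sbtw a b c) : a ≠ b := by
  rintro rfl
  exact sbtw_irrefl_left h

theorem PairSeparates.flip_left {x y z u : X} (h : PairSeparates x y z u) :
    PairSeparates y x z u := by
  unfold PairSeparates at *
  tauto

theorem PairSeparates.flip_right {x y z u : X} (h : PairSeparates x y z u) :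
    PairSeparates x y u z := by
  unfold PairSeparates at *
  tauto

theorem PairSeparates.pairwise_ne {x y z u : X} (h : PairSeparates x y z u) :
    x ≠ y ∧ x ≠ z ∧ x ≠ u ∧ y ≠ z ∧ y ≠ u ∧ z ≠ u := by
  refine ⟨?_, ?_, ?_, ?_, ?_, ?_⟩ <;> rintro rfl <;> rcases h with ⟨h₁, h₂⟩ | ⟨h₁, h₂⟩
  all_goals first
    | exact sbtw_irrefl_left_right h₁
    | exact sbtw_irrefl_left h₁
    | exact sbtw_irrefl_right h₁
    | exact sbtw_irrefl_left h₂
    | exact sbtw_irrefl_right h₂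
    | exact sbtw_asymm h₁ h₂

theorem pairSeparates_of_cut {ω a b c : X} (hab : sbtw ω a b) (hbc : sbtw ω b c) :
    PairSeparates a c b ω :=
  Or.inl ⟨sbtw_of_cut hab hbc, (sbtw_cut_trans hab hbc).cyclic_right⟩

theorem PairSeparates.cut {x y z ω : X} (h : PairSeparates x y z ω) :
    (sbtw ω x z ∧ sbtw ω z y) ∨ (sbtw ω y z ∧ sbtw ω z x) := by
  have key : ∀ {x y : X}, sbtw x z y → sbtw y ω x → sbtw ω x z ∧ sbtw ω z y := by
    intro x y h₁ h₂
    exact ⟨(sbtw_trans_right h₁ h₂.cyclic_right).cyclic_right,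
      SBtw.sbtw.trans_left h₂.cyclic_left h₁⟩
  rcases h with ⟨h₁, h₂⟩ | ⟨h₁, h₂⟩
  · exact Or.inl (key h₁ h₂)
  · exact Or.inr (key h₂ h₁)

/-- Among three pairings of four distinct points, one is separating. -/
theorem exists_pairSeparates {x y z u : X} (hxy : x ≠ y) (hxz : x ≠ z) (hxu : x ≠ u)
    (hyz : y ≠ z) (hyu : y ≠ u) (hzu : z ≠ u) :
    PairSeparates x y z u ∨ PairSeparates x z y u ∨ PairSeparates x u y z := by
  have mid : ∀ {a b c : X}, sbtw x a b → sbtw x b c → PairSeparates x b a c := fun hab hbc =>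
    Or.inl ⟨hab, hbc.cyclic_left⟩
  have asymm : ∀ {a b : X}, sbtw x a b → ¬ sbtw x b a := fun hab hba =>
    sbtw_asymm hab.cyclic_right hba.cyclic_right
  rcases sbtw_cut_or hxy.symm hxz.symm hyz with h₁ | h₁ <;>
  rcases sbtw_cut_or hxy.symm hxu.symm hyu with h₂ | h₂ <;>
  rcases sbtw_cut_or hxz.symm hxu.symm hzu with h₃ | h₃
  · exact Or.inr (Or.inl (mid h₁ h₃))
  · exact Or.inr (Or.inr (mid h₂ h₃))
  · exact absurd h₂ (asymm (sbtw_cut_trans h₁ h₃))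
  · exact Or.inl (mid h₂ h₁).flip_right
  · exact Or.inl (mid h₁ h₂)
  · exact absurd h₃ (asymm (sbtw_cut_trans h₁ h₂))
  · exact Or.inr (Or.inr (mid h₃ h₂).flip_right)
  · exact Or.inr (Or.inl (mid h₃ h₁).flip_right)

end CircularOrderLemmas

namespace MonotoneMobius

theorem infinite {X : Type*} [CircularOrder X] [TopologicalSpace X] (M : MonotoneMobius X) :
    Infinite X := by
  obtain ⟨e⟩ := M.circle
  have : Fact ((0 : ℝ) < 1) := ⟨one_pos⟩
  have : Infinite (Set.Ico (0 : ℝ) (0 + 1)) :=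
    Set.infinite_coe_iff.mpr (Set.Ico_infinite (by norm_num))
  exact Infinite.of_injective _ ((AddCircle.equivIco (1 : ℝ) 0).symm.trans e.symm.toEquiv).injective

theorem exists_ne_of_four {X : Type*} [CircularOrder X] [TopologicalSpace X]
    (M : MonotoneMobius X) (a b c d : X) : ∃ e : X, e ≠ a ∧ e ≠ b ∧ e ≠ c ∧ e ≠ d := by
  have := M.infinite
  obtain ⟨e, he⟩ := Infinite.exists_notMem_finset ({a, b, c, d} : Finset X)
  exact ⟨e, by simpa using he⟩

variable {X : Type*} [CircularOrder X] [TopologicalSpace X] {M : MonotoneMobius X}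

/-- In the semi-metric with infinitely remote point `ω`, a point between `a` and `c` is closer
to each of them than they are to each other. -/
theorem D_lt_of_pairSeparates {a b c ω : X} (h : PairSeparates a c b ω) :
    M.D ω a b < M.D ω a c ∧ M.D ω c b < M.D ω a c := by
  obtain ⟨hac, hab, haω, hcb, hcω, hbω⟩ := h.pairwise_ne
  obtain ⟨e, hea, heb, hec, heω⟩ := M.exists_ne_of_four a b c ω
  obtain ⟨k, hk, hinv⟩ := M.inversion e ω heω
  obtain ⟨h₁, h₂⟩ := M.mono e a c b ω hea.symm hec.symm heb.symm heω.symm h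
  have pa := M.pos e a ω haω hea.symm heω.symm
  have pb := M.pos e b ω hbω heb.symm heω.symm
  have pc := M.pos e c ω hcω hec.symm heω.symm
  rw [hinv a b hea.symm heb.symm haω hbω, hinv a c hea.symm hec.symm haω hcω,
    hinv c b hec.symm heb.symm hcω hbω, div_lt_div_iff₀ (by positivity) (by positivity),
    div_lt_div_iff₀ (by positivity) (by positivity)]
  constructor
  · have := mul_lt_mul_of_pos_left h₁ (mul_pos hk pa)
    linarith
  · have := mul_lt_mul_of_pos_left h₂ (mul_pos hk pc)
    linarith

/-- Points that both lie between `x` and `y` are ordered consistently by their distances to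
`x` and to `y`. -/
theorem D_lt_or_lt_of_between {x y p p' ω : X} (h : PairSeparates x y p ω)
    (h' : PairSeparates x y p' ω) (hne : p ≠ p') :
    (M.D ω x p < M.D ω x p' ∧ M.D ω y p' < M.D ω y p) ∨
      (M.D ω x p' < M.D ω x p ∧ M.D ω y p < M.D ω y p') := by
  have key : ∀ {x y p p' : X}, sbtw ω x p → sbtw ω p p' → sbtw ω p' y →
      M.D ω x p < M.D ω x p' ∧ M.D ω y p' < M.D ω y p := fun h₁ h₂ h₃ =>
    ⟨(D_lt_of_pairSeparates (pairSeparates_of_cut h₁ h₂)).1,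
      (D_lt_of_pairSeparates (pairSeparates_of_cut h₂ h₃).flip_left).1⟩
  obtain ⟨-, -, -, -, -, hp⟩ := h.pairwise_ne
  obtain ⟨-, -, -, -, -, hp'⟩ := h'.pairwise_ne
  have asymm : ∀ {a b : X}, sbtw ω a b → ¬ sbtw ω b a := fun hab hba =>
    sbtw_asymm hab.cyclic_right hba.cyclic_right
  rcases h.cut with ⟨h₁, h₂⟩ | ⟨h₁, h₂⟩ <;> rcases h'.cut with ⟨h₃, h₄⟩ | ⟨h₃, h₄⟩
  · rcases sbtw_cut_or hp hp' hne with h | h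
    · exact Or.inl (key h₁ h h₄)
    · exact Or.inr (key h₃ h h₂)
  · exact absurd (sbtw_cut_trans h₃ h₄) (asymm (sbtw_cut_trans h₁ h₂))
  · exact absurd (sbtw_cut_trans h₃ h₄) (asymm (sbtw_cut_trans h₁ h₂))
  · rcases sbtw_cut_or hp hp' hne with h | h
    · exact Or.inr (key h₁ h h₄).symm
    · exact Or.inl (key h₃ h h₂).symm

/-- A point between `x` and `y` is closer to both of them than its harmonic conjugate. -/
theorem D_lt_of_outside {x y p r ω : X} (hp : PairSeparates x y p ω)
    (hr : PairSeparates x y p r) (hrω : r ≠ ω)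
    (heq : M.D ω x p * M.D ω y r = M.D ω x r * M.D ω y p) :
    M.D ω x p < M.D ω x r ∧ M.D ω y p < M.D ω y r := by
  have key : ∀ {x y : X}, PairSeparates x y p r → sbtw ω x p → sbtw ω p y →
      M.D ω x p < M.D ω x r ∨ M.D ω y p < M.D ω y r := by
    intro x y hr h₁ h₂
    obtain ⟨-, -, hxr, -, hyr, -⟩ := hr.pairwise_ne
    have hr' : sbtw y r x := by
      rcases hr with h | h
      · exact h.2
      · exact absurd h.2 (sbtw_asymm (sbtw_of_cut h₁ h₂))
    rcases sbtw_cut_or hrω h₁.ne_left.symm hxr.symm with h | h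
    · have := (D_lt_of_pairSeparates (M := M)
        (pairSeparates_of_cut (sbtw_cut_trans h h₁) h₂)).2
      rw [M.symm ω r y] at this
      exact Or.inr this
    · rcases sbtw_cut_or hrω (h₂.cyclic_left.cyclic_left.ne_left) hyr.symm with h' | h'
      · exact absurd hr' (sbtw_asymm (sbtw_of_cut h h'))
      · exact Or.inl (D_lt_of_pairSeparates
          (pairSeparates_of_cut h₁ (sbtw_cut_trans h₂ h'))).1
  obtain ⟨-, hxp, hxω, hyp, hyω, hpω⟩ := hp.pairwise_ne
  obtain ⟨-, -, hxr, -, hyr, -⟩ := hr.pairwise_ne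
  have p₁ := M.pos ω x p hxp hxω hpω
  have p₂ := M.pos ω y p hyp hyω hpω
  have p₃ := M.pos ω x r hxr hxω hrω
  have p₄ := M.pos ω y r hyr hyω hrω
  have h : M.D ω x p < M.D ω x r ∨ M.D ω y p < M.D ω y r := by
    rcases hp.cut with ⟨h₁, h₂⟩ | ⟨h₁, h₂⟩
    · exact key hr h₁ h₂
    · exact (key hr.flip_left h₁ h₂).symm
  rcases h with h | h
  · exact ⟨h, by by_contra! hle; nlinarith⟩
  · exact ⟨by by_contra! hle; nlinarith, h⟩

theorem Harmonic.pairSeparates {x y z u : X} (h : M.Harmonic x y z u) (hxy : x ≠ y)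
    (hxz : x ≠ z) (hxu : x ≠ u) (hyz : y ≠ z) (hyu : y ≠ u) (hzu : z ≠ u) :
    PairSeparates x y z u := by
  obtain ⟨ω, hx, hy, hz, hu⟩ := M.exists_ne_of_four x y z u
  have heq := h ω hx hy hz hu
  rcases exists_pairSeparates hxy hxz hxu hyz hyu hzu with h | h | h
  · exact h
  · have := (M.mono ω x z y u hx.symm hz.symm hy.symm hu.symm h).2
    rw [M.symm ω z y] at this
    exact absurd heq this.ne'
  · have := (M.mono ω x u y z hx.symm hu.symm hy.symm hz.symm h)
    rw [M.symm ω u z, M.symm ω u y] at this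
    exact absurd heq.symm this.2.ne'

/-- Distances to `y` in the semi-metric with infinitely remote point `x`, in terms of any other
semi-metric. -/
theorem exists_D_eq {x y ω : X} (hxy : x ≠ y) (hx : ω ≠ x) (hy : ω ≠ y) :
    ∃ k : ℝ, 0 < k ∧ ∀ z, z ≠ x → z ≠ ω → M.D x y z = k * (M.D ω y z / M.D ω x z) := by
  obtain ⟨c, hc, hinv⟩ := M.inversion ω x hx
  have hpos := M.pos ω y x hxy.symm hy.symm hx.symm
  refine ⟨c / M.D ω y x, by positivity, fun z hzx hzω => ?_⟩
  rw [hinv y z hy.symm hzω hxy.symm hzx, M.symm ω z x]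
  field_simp

theorem Harmonic.D_eq {x y z u : X} (h : M.Harmonic x y z u) (hxy : x ≠ y)
    (hxz : x ≠ z) (hxu : x ≠ u) : M.D x y z = M.D x y u := by
  obtain ⟨ω, hx, hy, hz, hu⟩ := M.exists_ne_of_four x y z u
  obtain ⟨k, -, hD⟩ := exists_D_eq (M := M) hxy hx hy
  have heq := h ω hx hy hz hu
  have pz := M.pos ω x z hxz hx.symm hz.symm
  have pu := M.pos ω x u hxu hx.symm hu.symm
  rw [hD z hxz.symm hz.symm, hD u hxu.symm hu.symm]
  congr 1
  rw [div_eq_div_iff pz.ne' pu.ne']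
  linarith

/-- Two points that are separated from `p` by `(x,y)` and are equidistant from `y` in the
semi-metric with infinitely remote point `x` coincide. -/
theorem eq_of_D_eq {x y p r r' : X} (hr : PairSeparates x y p r) (hr' : PairSeparates x y p r')
    (h : M.D x y r = M.D x y r') : r = r' := by
  by_contra hne
  obtain ⟨hxy, -, hxr, -, hyr, -⟩ := hr.pairwise_ne
  obtain ⟨-, -, hxr', -, hyr', -⟩ := hr'.pairwise_ne
  have key : ∀ {r r' : X}, sbtw y r x → sbtw x r r' →
      M.D x y r < M.D x y r' := fun h₁ h₃ =>
    (D_lt_of_pairSeparates (pairSeparates_of_cut h₁.cyclic_right h₃)).1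
  have key' : ∀ {r r' : X}, sbtw x r' y → sbtw x r r' →
      M.D x y r' < M.D x y r := fun {r _} h₂ h₃ => by
    have := (D_lt_of_pairSeparates (M := M) (pairSeparates_of_cut h₃ h₂)).2
    rwa [M.symm x r y] at this
  rcases hr with ⟨h₁, h₂⟩ | ⟨h₁, h₂⟩ <;> rcases hr' with ⟨h₃, h₄⟩ | ⟨h₃, h₄⟩
  · rcases sbtw_cut_or hxr.symm hxr'.symm hne with h' | h'
    · exact (key h₂ h').ne h
    · exact (key h₄ h').ne' h
  · exact sbtw_asymm h₁ h₄
  · exact sbtw_asymm h₂ h₃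
  · rcases sbtw_cut_or hxr.symm hxr'.symm hne with h' | h'
    · exact (key' h₃ h').ne' h
    · exact (key' h₁ h').ne h

theorem lineDist_eq {x y p p' ω : X} (hxy : x ≠ y) (hx : ω ≠ x) (hy : ω ≠ y) (hp : p ≠ ω)
    (hp' : p' ≠ ω) (hpx : p ≠ x) (hpx' : p' ≠ x) :
    M.lineDist x y p p' =
      |Real.log (M.D ω y p / M.D ω x p / (M.D ω y p' / M.D ω x p'))| := by
  obtain ⟨k, hk, hD⟩ := exists_D_eq (M := M) hxy hx hy
  rw [lineDist, hD p hpx hp, hD p' hpx' hp', mul_div_mul_left _ _ hk.ne']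

theorem lineDist_comm_axis {x y p p' : X} (hxy : x ≠ y) (hpx : p ≠ x) (hpy : p ≠ y)
    (hpx' : p' ≠ x) (hpy' : p' ≠ y) : M.lineDist x y p p' = M.lineDist y x p p' := by
  obtain ⟨ω, hx, hy, hp, hp'⟩ := M.exists_ne_of_four x y p p'
  rw [lineDist_eq hxy hx hy hp.symm hp'.symm hpx hpx',
    lineDist_eq hxy.symm hy hx hp.symm hp'.symm hpy hpy', ← abs_neg, ← Real.log_inv]
  congr 2
  rw [inv_div, ← inv_div (M.D ω x p'), ← inv_div (M.D ω x p), inv_div_inv]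

/-- The distance between two points in the semi-metric with infinitely remote point `ω`, which is
infinite if one of them is `ω`. -/
noncomputable def extDist (M : MonotoneMobius X) (ω a b : X) : ENNReal :=
  if a = ω ∨ b = ω then ⊤ else ENNReal.ofReal (M.D ω a b)

end MonotoneMobius

theorem abs_log_min_sub_lt {a b a' b' : ℝ} (ha : 0 < a) (hb : 0 < b) (ha' : 0 < a')
    (hb' : 0 < b') (h : (a < a' ∧ b' < b) ∨ (a' < a ∧ b < b')) :
    |Real.log (min a b) - Real.log (min a' b')| < |Real.log (b / a / (b' / a'))| := by
  have hlog : ∀ {a b : ℝ}, 0 < a → 0 < b →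
      Real.log (min a b) = min (Real.log a) (Real.log b) := by
    intro a b ha hb
    rcases le_total a b with h | h
    · rw [min_eq_left h, min_eq_left (Real.log_le_log ha h)]
    · rw [min_eq_right h, min_eq_right (Real.log_le_log hb h)]
  rw [hlog ha hb, hlog ha' hb', Real.log_div (by positivity) (by positivity),
    Real.log_div hb.ne' ha.ne', Real.log_div hb'.ne' ha'.ne']
  rcases h with ⟨h₁, h₂⟩ | ⟨h₁, h₂⟩
  · have := Real.log_lt_log ha h₁
    have := Real.log_lt_log hb' h₂
    refine lt_of_lt_of_le ?_ (le_abs_self _)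
    rw [abs_lt]
    constructor <;> cases min_cases (Real.log a) (Real.log b) <;>
      cases min_cases (Real.log a') (Real.log b') <;> linarith
  · have := Real.log_lt_log ha' h₁
    have := Real.log_lt_log hb h₂
    refine lt_of_lt_of_le ?_ (neg_le_abs _)
    rw [abs_lt]
    constructor <;> cases min_cases (Real.log a) (Real.log b) <;>
      cases min_cases (Real.log a') (Real.log b') <;> linarith

namespace HarmPt

variable {X : Type*} [CircularOrder X] [TopologicalSpace X] {M : MonotoneMobius X}

/-- The harmonic pair with the two axes exchanged. -/
def swap (q : HarmPt M) : HarmPt M where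
  x := q.z
  y := q.u
  z := q.x
  u := q.y
  hxy := q.hzu
  hxz := q.hxz.symm
  hxu := q.hyz.symm
  hyz := q.hxu.symm
  hyu := q.hyu.symm
  hzu := q.hxy
  harm ω hz hu hx hy := by
    have := q.harm ω hx hy hz hu
    rw [M.symm ω q.z q.x, M.symm ω q.u q.y, M.symm ω q.z q.y, M.symm ω q.u q.x]
    linarith

/-- The harmonic pair with the entries of the left axis exchanged. -/
def flipLeft (q : HarmPt M) : HarmPt M where
  x := q.y
  y := q.x
  z := q.z
  u := q.u
  hxy := q.hxy.symm
  hxz := q.hyz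
  hxu := q.hyu
  hyz := q.hxz
  hyu := q.hxu
  hzu := q.hzu
  harm ω hy hx hz hu := by
    have := q.harm ω hx hy hz hu
    linarith

/-- The height of a harmonic pair with respect to `ω`, an analogue of the exponential of the
Busemann function: the smallest distance between a point of the left axis and a point of the
right axis. -/
noncomputable def height (ω : X) (q : HarmPt M) : ℝ :=
  (min (min (M.extDist ω q.x q.z) (M.extDist ω q.y q.z))
    (min (M.extDist ω q.x q.u) (M.extDist ω q.y q.u))).toReal

theorem height_swap (ω : X) (q : HarmPt M) : q.swap.height ω = q.height ω := by
  have hs : ∀ a b, M.extDist ω a b = M.extDist ω b a := fun a b => by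
    simp only [MonotoneMobius.extDist, M.symm ω a b, or_comm]
  simp only [height, swap]
  rw [hs q.z q.x, hs q.u q.x, hs q.z q.y, hs q.u q.y, min_min_min_comm]

theorem height_flipLeft (ω : X) (q : HarmPt M) : q.flipLeft.height ω = q.height ω := by
  simp only [height, flipLeft]
  rw [min_comm (M.extDist ω q.y q.z), min_comm (M.extDist ω q.y q.u)]

theorem pairSeparates (q : HarmPt M) : PairSeparates q.x q.y q.z q.u :=
  q.harm.pairSeparates q.hxy q.hxz q.hxu q.hyz q.hyu q.hzu

theorem D_eq (q : HarmPt M) : M.D q.x q.y q.z = M.D q.x q.y q.u :=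
  q.harm.D_eq q.hxy q.hxz q.hxu

theorem height_left (q : HarmPt M) : q.height q.x = M.D q.x q.y q.z := by
  have hpos := (M.pos q.x q.y q.z q.hyz q.hxy.symm q.hxz.symm).le
  simp [height, MonotoneMobius.extDist, q.hxy.symm, q.hxz.symm, q.hxu.symm, ← q.D_eq, hpos]

/-- The right axis of `q` has an entry `p` that is separated from `ω` by the left axis. -/
theorem exists_inner (q : HarmPt M) {ω : X} (hx : ω ≠ q.x) (hy : ω ≠ q.y) :
    ∃ p r, (p = q.z ∧ r = q.u ∨ p = q.u ∧ r = q.z) ∧ PairSeparates q.x q.y p ω ∧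
      q.height ω = min (M.D ω q.x p) (M.D ω q.y p) := by
  have main : ∀ {p r : X}, PairSeparates q.x q.y p r → PairSeparates q.x q.y p ω →
      (r ≠ ω → M.D ω q.x p * M.D ω q.y r = M.D ω q.x r * M.D ω q.y p) →
      (min (min (M.extDist ω q.x p) (M.extDist ω q.y p))
        (min (M.extDist ω q.x r) (M.extDist ω q.y r))).toReal =
        min (M.D ω q.x p) (M.D ω q.y p) := by
    intro p r hr hp heq
    obtain ⟨-, hxp, -, hyp, -, hpω⟩ := hp.pairwise_ne
    have p₁ := M.pos ω q.x p hxp hx.symm hpω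
    have p₂ := M.pos ω q.y p hyp hy.symm hpω
    have hle : M.extDist ω q.x p ≤ M.extDist ω q.x r ∧ M.extDist ω q.y p ≤ M.extDist ω q.y r := by
      by_cases hrω : r = ω
      · simp [MonotoneMobius.extDist, hrω]
      · obtain ⟨h₁, h₂⟩ := MonotoneMobius.D_lt_of_outside hp hr hrω (heq hrω)
        simp only [MonotoneMobius.extDist, hx.symm, hy.symm, hpω, hrω, or_self, if_false]
        exact ⟨ENNReal.ofReal_le_ofReal h₁.le, ENNReal.ofReal_le_ofReal h₂.le⟩
    rw [min_eq_left (min_le_min hle.1 hle.2)]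
    simp only [MonotoneMobius.extDist, hx.symm, hy.symm, hpω, or_self, if_false]
    rw [ENNReal.toReal_min ENNReal.ofReal_ne_top ENNReal.ofReal_ne_top,
      ENNReal.toReal_ofReal p₁.le, ENNReal.toReal_ofReal p₂.le]
  have hs := q.pairSeparates
  have inner : PairSeparates q.x q.y q.z ω ∨ PairSeparates q.x q.y q.u ω := by
    rcases sbtw_or_sbtw_of_ne hx.symm hy q.hxy with h | h <;> rcases hs with hs | hs
    · exact Or.inr (Or.inr ⟨h, hs.2⟩)
    · exact Or.inl (Or.inr ⟨h, hs.2⟩)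
    · exact Or.inl (Or.inl ⟨hs.1, h.cyclic_left⟩)
    · exact Or.inr (Or.inl ⟨hs.1, h.cyclic_left⟩)
  have harm : q.z ≠ ω → q.u ≠ ω →
      M.D ω q.x q.z * M.D ω q.y q.u = M.D ω q.x q.u * M.D ω q.y q.z :=
    fun hz hu => q.harm ω hx hy hz.symm hu.symm
  rcases inner with h | h
  · obtain ⟨-, -, -, -, -, hzω⟩ := h.pairwise_ne
    exact ⟨q.z, q.u, Or.inl ⟨rfl, rfl⟩, h, main hs h (harm hzω)⟩
  · obtain ⟨-, -, -, -, -, huω⟩ := h.pairwise_ne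
    refine ⟨q.u, q.z, Or.inr ⟨rfl, rfl⟩, h, ?_⟩
    rw [← main hs.flip_right h fun hz => (harm hz huω).symm, height, min_comm]

/-- Sliding a harmonic pair along its left axis, when the axis does not contain `ω`. -/
theorem abs_log_height_sub_lt_of_same_axis {q q' : HarmPt M} {ω : X} (hqx : q'.x = q.x)
    (hqy : q'.y = q.y) (hx : ω ≠ q.x) (hy : ω ≠ q.y) (hne : ¬ rightAxisEq q q') :
    |Real.log (q.height ω) - Real.log (q'.height ω)| < stepDistL q q' := by
  obtain ⟨p, r, hpr, hp, hh⟩ := q.exists_inner hx hy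
  obtain ⟨p', r', hpr', hp', hh'⟩ := q'.exists_inner (hqx ▸ hx) (hqy ▸ hy)
  rw [hqx, hqy] at hp' hh'
  have hD := q.D_eq
  have hD' := q'.D_eq
  rw [hqx, hqy] at hD'
  have hsep : PairSeparates q.x q.y p r := by
    rcases hpr with ⟨rfl, rfl⟩ | ⟨rfl, rfl⟩
    exacts [q.pairSeparates, q.pairSeparates.flip_right]
  have hsep' : PairSeparates q.x q.y p' r' := by
    rw [← hqx, ← hqy]
    rcases hpr' with ⟨rfl, rfl⟩ | ⟨rfl, rfl⟩
    exacts [q'.pairSeparates, q'.pairSeparates.flip_right]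
  have hdist : stepDistL q q' = M.lineDist q.x q.y p p' := by
    unfold stepDistL MonotoneMobius.lineDist
    rcases hpr with ⟨rfl, -⟩ | ⟨rfl, -⟩ <;> rcases hpr' with ⟨rfl, -⟩ | ⟨rfl, -⟩ <;>
      simp only [hD, hD']
  have hpp : p ≠ p' := by
    rintro rfl
    have hrr : r = r' := by
      refine MonotoneMobius.eq_of_D_eq (M := M) hsep hsep' ?_
      rcases hpr with ⟨h₁, h₂⟩ | ⟨h₁, h₂⟩ <;> rcases hpr' with ⟨h₃, h₄⟩ | ⟨h₃, h₄⟩ <;> grind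
    apply hne
    unfold rightAxisEq
    rcases hpr with ⟨h₁, h₂⟩ | ⟨h₁, h₂⟩ <;> rcases hpr' with ⟨h₃, h₄⟩ | ⟨h₃, h₄⟩ <;> grind
  obtain ⟨-, hxp, -, hyp, -, hpω⟩ := hp.pairwise_ne
  obtain ⟨-, hxp', -, hyp', -, hpω'⟩ := hp'.pairwise_ne
  rw [hdist, MonotoneMobius.lineDist_eq q.hxy hx hy hpω hpω' hxp.symm hxp'.symm, hh, hh']
  exact abs_log_min_sub_lt (M.pos ω q.x p hxp hx.symm hpω) (M.pos ω q.y p hyp hy.symm hpω)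
    (M.pos ω q.x p' hxp' hx.symm hpω') (M.pos ω q.y p' hyp' hy.symm hpω')
    (MonotoneMobius.D_lt_or_lt_of_between hp hp' hpp)

/-- Two points on a left line can be presented with the same ordered left axis. -/
theorem exists_same_axis {q q' : HarmPt M} (hax : leftAxisEq q q') :
    ∃ q'' : HarmPt M, q''.x = q.x ∧ q''.y = q.y ∧ q''.z = q'.z ∧ q''.u = q'.u ∧
      ∀ ω, q''.height ω = q'.height ω := by
  rcases hax with ⟨hx, hy⟩ | ⟨hx, hy⟩
  · exact ⟨q', hx.symm, hy.symm, rfl, rfl, fun _ => rfl⟩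
  · exact ⟨q'.flipLeft, hx.symm, hy.symm, rfl, rfl, fun ω => q'.height_flipLeft ω⟩

theorem abs_log_height_sub_lt_stepDistL {q q' : HarmPt M} {ω : X} (hx : ω ≠ q.x) (hy : ω ≠ q.y)
    (hax : leftAxisEq q q') (hne : ¬ rightAxisEq q q') :
    |Real.log (q.height ω) - Real.log (q'.height ω)| < stepDistL q q' := by
  obtain ⟨q'', h₁, h₂, h₃, h₄, hh⟩ := exists_same_axis hax
  have hne' : ¬ rightAxisEq q q'' := by rwa [rightAxisEq, h₃, h₄]
  have := abs_log_height_sub_lt_of_same_axis h₁ h₂ hx hy hne'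
  rwa [hh, stepDistL, h₃] at this

theorem abs_log_height_left_sub {q q' : HarmPt M} (hax : leftAxisEq q q') :
    |Real.log (q.height q.x) - Real.log (q'.height q.x)| = stepDistL q q' := by
  obtain ⟨q'', h₁, h₂, h₃, h₄, hh⟩ := exists_same_axis hax
  have h := q''.height_left
  rw [h₁, h₂, h₃, hh] at h
  have hxz : q.x ≠ q'.z := h₁ ▸ h₃ ▸ q''.hxz
  have hyz : q.y ≠ q'.z := h₂ ▸ h₃ ▸ q''.hyz
  rw [h, q.height_left, stepDistL, MonotoneMobius.lineDist,
    Real.log_div (M.pos q.x q.y q.z q.hyz q.hxy.symm q.hxz.symm).ne'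
      (M.pos q.x q.y q'.z hyz q.hxy.symm hxz.symm).ne']

theorem stepDistL_flipLeft {q q' : HarmPt M} (hax : leftAxisEq q q') :
    stepDistL q.flipLeft q' = stepDistL q q' := by
  obtain ⟨q'', h₁, h₂, h₃, -, -⟩ := exists_same_axis hax
  have hxz : q.x ≠ q'.z := h₁ ▸ h₃ ▸ q''.hxz
  have hyz : q.y ≠ q'.z := h₂ ▸ h₃ ▸ q''.hyz
  exact (MonotoneMobius.lineDist_comm_axis q.hxy q.hxz.symm q.hyz.symm hxz.symm hyz.symm).symm

theorem abs_log_height_sub_le_stepDistL {q q' : HarmPt M} (ω : X)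
    (hax : leftAxisEq q q') (hne : ¬ rightAxisEq q q') :
    |Real.log (q.height ω) - Real.log (q'.height ω)| ≤ stepDistL q q' := by
  by_cases hx : ω = q.x
  · exact hx ▸ (abs_log_height_left_sub hax).le
  by_cases hy : ω = q.y
  · have hax' : leftAxisEq q.flipLeft q' := hax.symm.imp And.symm And.symm
    have := abs_log_height_left_sub hax'
    rw [height_flipLeft, stepDistL_flipLeft hax] at this
    exact hy ▸ this.le
  · exact (abs_log_height_sub_lt_stepDistL hx hy hax hne).le

theorem abs_log_height_sub_lt_stepDistR {q q' : HarmPt M} {ω : X} (hz : ω ≠ q.z) (hu : ω ≠ q.u)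
    (hax : rightAxisEq q q') (hne : ¬ leftAxisEq q q') :
    |Real.log (q.height ω) - Real.log (q'.height ω)| < stepDistR q q' := by
  have := abs_log_height_sub_lt_stepDistL (q := q.swap) (q' := q'.swap) hz hu hax hne
  rwa [height_swap, height_swap] at this

theorem abs_log_height_right_sub {q q' : HarmPt M} (hax : rightAxisEq q q') :
    |Real.log (q.height q.z) - Real.log (q'.height q.z)| = stepDistR q q' := by
  have := abs_log_height_left_sub (q := q.swap) (q' := q'.swap) hax
  rwa [height_swap, height_swap] at this

theorem abs_log_height_sub_le_stepDistR {q q' : HarmPt M} (ω : X)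
    (hax : rightAxisEq q q') (hne : ¬ leftAxisEq q q') :
    |Real.log (q.height ω) - Real.log (q'.height ω)| ≤ stepDistR q q' := by
  have := abs_log_height_sub_le_stepDistL (q := q.swap) (q' := q'.swap) ω hax hne
  rwa [height_swap, height_swap] at this

theorem abs_log_height_sub_le_of_zz (ω : X) {q q' : HarmPt M} {b : Bool} {n : ℕ} {L : ℝ}
    (h : ZZ q q' b n L) : |Real.log (q.height ω) - Real.log (q'.height ω)| ≤ L := by
  induction h with
  | nil => simp
  | left hne hax _ ih =>
    exact (abs_sub_le _ _ _).trans
      (add_le_add (abs_log_height_sub_le_stepDistL ω hax hne) ih)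
  | right hne hax _ ih =>
    exact (abs_sub_le _ _ _).trans
      (add_le_add (abs_log_height_sub_le_stepDistR ω hax hne) ih)

end HarmPt

/-- Let `M` be a monotone Möbius structure on the circle satisfying the
Increment axiom. For any closed zig-zag path `S ⊂ Harm` and any side `σ` of `S`, the length
of `σ` is strictly less than the sum of the lengths of the other sides:
`|σ| < Σ_{σ' ≠ σ} |σ'|`.

A closed zig-zag path with distinguished side `σ` from `q` to `q'` is encoded as the side
`σ` together with an alternating zig-zag path of the complementary sides from `q'` back to
`q`; alternation around the closed path forces the complementary path to begin and end with
sides of the kind opposite to `σ`, i.e. to have an odd number of sides. -/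
theorem stmt18 {X : Type*} [CircularOrder X] [TopologicalSpace X]
    {M : MonotoneMobius X} (hI : M.Increment) :
    (∀ q q' : HarmPt M, ¬ rightAxisEq q q' → leftAxisEq q q' →
      ∀ (n : ℕ) (L : ℝ), Odd n → ZZ q' q false n L → stepDistL q q' < L) ∧
    (∀ q q' : HarmPt M, ¬ leftAxisEq q q' → rightAxisEq q q' →
      ∀ (n : ℕ) (L : ℝ), Odd n → ZZ q' q true n L → stepDistR q q' < L) := by
  constructor
  · intro q q' _ hax n L hn h
    rcases h with _ | _ | @⟨_, p, _, n, L, hne, hax', rest⟩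
    · exact absurd hn (by decide)
    rw [← HarmPt.abs_log_height_left_sub hax, abs_sub_comm]
    have hz : q.x ≠ q'.z := by
      rcases hax with ⟨h, -⟩ | ⟨h, -⟩
      exacts [h ▸ q'.hxz, h ▸ q'.hyz]
    have hu : q.x ≠ q'.u := by
      rcases hax with ⟨h, -⟩ | ⟨h, -⟩
      exacts [h ▸ q'.hxu, h ▸ q'.hyu]
    exact (abs_sub_le _ _ _).trans_lt (add_lt_add_of_lt_of_le
      (HarmPt.abs_log_height_sub_lt_stepDistR hz hu hax' hne)
      (HarmPt.abs_log_height_sub_le_of_zz q.x rest))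
  · intro q q' _ hax n L hn h
    rcases h with _ | @⟨_, p, _, n, L, hne, hax', rest⟩ | _
    · exact absurd hn (by decide)
    rw [← HarmPt.abs_log_height_right_sub hax, abs_sub_comm]
    have hx : q.z ≠ q'.x := by
      rcases hax with ⟨h, -⟩ | ⟨h, -⟩
      exacts [h ▸ q'.hxz.symm, h ▸ q'.hxu.symm]
    have hy : q.z ≠ q'.y := by
      rcases hax with ⟨h, -⟩ | ⟨h, -⟩
      exacts [h ▸ q'.hyz.symm, h ▸ q'.hyu.symm]
    exact (abs_sub_le _ _ _).trans_lt (add_lt_add_of_lt_of_le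
      (HarmPt.abs_log_height_sub_lt_stepDistL hx hy hax' hne)
      (HarmPt.abs_log_height_sub_le_of_zz q.z rest))
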